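/- arXiv:1208.6366 — 12 statements merged into one kernel-verified Lean document; each statement's English description precedes it below -/
import Mathlib

section
/- (Equational criterion for Mitsch's order on B_X.) For binary relations α, β on a set X, α ≤ β in Mitsch's natural partial order if and only if α = α(β⁻¹αᶜ)ᶜ = β(β⁻¹αᶜ)ᶜ = (αᶜβ⁻¹)ᶜβ (that is, all four relations are equal). -/
/-- Left-to-right composition of binary relations on `X`:
`rcomp a b = {(x,z) : ∃ y, (x,y) ∈ a ∧ (y,z) ∈ b}`. -/
def rcomp {X : Type*} (a b : Set (X × X)) : Set (X × X) :=
  {p | ∃ y, (p.1, y) ∈ a ∧ (y, p.2) ∈ b}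

/-- Converse of a binary relation. -/
def rconv {X : Type*} (a : Set (X × X)) : Set (X × X) :=
  {p | (p.2, p.1) ∈ a}

/-- Mitsch's natural partial order on the monoid of binary relations:
`a ≤ b` iff `a = b` or there are `ξ, η` with `a = aξ = bξ = ηb`. -/
def mitschLe {X : Type*} (a b : Set (X × X)) : Prop :=
  a = b ∨ ∃ ξ η : Set (X × X), a = rcomp a ξ ∧ a = rcomp b ξ ∧ a = rcomp η b

theorem rcomp_assoc {X : Type*} (a b c : Set (X × X)) :
    rcomp (rcomp a b) c = rcomp a (rcomp b c) := by
  ext ⟨x, z⟩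
  constructor
  · rintro ⟨y, ⟨w, hw, hy⟩, hz⟩
    exact ⟨w, hw, y, hy, hz⟩
  · rintro ⟨w, hw, y, hy, hz⟩
    exact ⟨y, ⟨w, hw, hy⟩, hz⟩

theorem rcomp_mono {X : Type*} {a b c d : Set (X × X)} (h₁ : a ⊆ b) (h₂ : c ⊆ d) :
    rcomp a c ⊆ rcomp b d :=
  fun _ ⟨y, hy, hz⟩ => ⟨y, h₁ hy, h₂ hz⟩

theorem rcomp_diagonal {X : Type*} (a : Set (X × X)) : rcomp a (Set.diagonal X) = a := by
  ext ⟨x, z⟩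
  simp [rcomp]

theorem diagonal_rcomp {X : Type*} (a : Set (X × X)) : rcomp (Set.diagonal X) a = a := by
  ext ⟨x, z⟩
  simp [rcomp]

/-- `(b⁻¹aᶜ)ᶜ` is the right residual of `a` by `b`. -/
theorem rcomp_subset_iff_subset_right {X : Type*} {a b c : Set (X × X)} :
    rcomp b c ⊆ a ↔ c ⊆ (rcomp (rconv b) aᶜ)ᶜ := by
  constructor
  · rintro h ⟨y, z⟩ hc ⟨x, hb, ha⟩
    exact ha (h ⟨y, hb, hc⟩)
  · rintro h ⟨x, z⟩ ⟨y, hb, hc⟩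
    by_contra ha
    exact h hc ⟨x, hb, ha⟩

/-- `(aᶜb⁻¹)ᶜ` is the left residual of `a` by `b`. -/
theorem rcomp_subset_iff_subset_left {X : Type*} {a b c : Set (X × X)} :
    rcomp c b ⊆ a ↔ c ⊆ (rcomp aᶜ (rconv b))ᶜ := by
  constructor
  · rintro h ⟨x, y⟩ hc ⟨z, ha, hb⟩
    exact ha (h ⟨y, hc, hb⟩)
  · rintro h ⟨x, z⟩ ⟨y, hc, hb⟩
    by_contra ha
    exact h hc ⟨z, ha, hb⟩

theorem mitschLe_iff_exists {X : Type*} {a b : Set (X × X)} :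
    mitschLe a b ↔
      ∃ ξ η : Set (X × X), a = rcomp a ξ ∧ a = rcomp b ξ ∧ a = rcomp η b := by
  refine ⟨?_, Or.inr⟩
  rintro (rfl | h)
  · exact ⟨Set.diagonal X, Set.diagonal X, (rcomp_diagonal a).symm, (rcomp_diagonal a).symm,
      (diagonal_rcomp a).symm⟩
  · exact h

/-- Equational criterion for Mitsch's order on binary relations:
α ≤ β iff α = α(β⁻¹αᶜ)ᶜ = β(β⁻¹αᶜ)ᶜ = (αᶜβ⁻¹)ᶜβ. -/
theorem stmt4 {X : Type*} (α β : Set (X × X)) :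
    mitschLe α β ↔
      (α = rcomp α ((rcomp (rconv β) αᶜ)ᶜ) ∧
       α = rcomp β ((rcomp (rconv β) αᶜ)ᶜ) ∧
       α = rcomp ((rcomp αᶜ (rconv β))ᶜ) β) := by
  rw [mitschLe_iff_exists]
  refine ⟨?_, fun h => ⟨_, _, h⟩⟩
  rintro ⟨ξ, η, hαξ, hβξ, hηβ⟩
  have hβ : α = rcomp β ((rcomp (rconv β) αᶜ)ᶜ) :=
    (hβξ.subset.trans (rcomp_mono subset_rfl
      (rcomp_subset_iff_subset_right.1 hβξ.superset))).antisymm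
      (rcomp_subset_iff_subset_right.2 subset_rfl)
  have hη : α = rcomp ((rcomp αᶜ (rconv β))ᶜ) β :=
    (hηβ.subset.trans (rcomp_mono
      (rcomp_subset_iff_subset_left.1 hηβ.superset) subset_rfl)).antisymm
      (rcomp_subset_iff_subset_left.2 subset_rfl)
  refine ⟨?_, hβ, hη⟩
  calc α = rcomp α ξ := hαξ
    _ = rcomp (rcomp η β) ξ := congrArg (rcomp · ξ) hηβ
    _ = rcomp η (rcomp β ξ) := rcomp_assoc η β ξ
    _ = rcomp η (rcomp β ((rcomp (rconv β) αᶜ)ᶜ)) := congrArg (rcomp η) (hβξ.symm.trans hβ)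
    _ = rcomp (rcomp η β) ((rcomp (rconv β) αᶜ)ᶜ) := (rcomp_assoc η β _).symm
    _ = rcomp α ((rcomp (rconv β) αᶜ)ᶜ) := congrArg (rcomp · ((rcomp (rconv β) αᶜ)ᶜ)) hηβ.symm
end

section
/- Let S be a semigroup and T a subsemigroup of S which is regular, i.e. for every a ∈ T there exists x ∈ T with a = a*x*a. Then for a, b ∈ T, a ≤ b in the Mitsch order of T (with witnesses taken in T) if and only if a ≤ b in the Mitsch order of S (with witnesses taken in S). -/
/-- For a regular subsemigroup T of a semigroup S and a, b ∈ T, the Mitsch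
order of T (witnesses in T) agrees with the Mitsch order of S (witnesses
in S). -/
theorem stmt5 {S : Type*} [Semigroup S] (T : Subsemigroup S)
    (hreg : ∀ a ∈ T, ∃ x ∈ T, a = a * x * a)
    (a b : S) (ha : a ∈ T) (hb : b ∈ T) :
    (a = b ∨ ∃ x ∈ T, ∃ y ∈ T, a = a * x ∧ a = b * x ∧ a = y * b) ↔
    (a = b ∨ ∃ x y : S, a = a * x ∧ a = b * x ∧ a = y * b) := by
  constructor
  · rintro (h | ⟨x, -, y, -, h⟩)
    · exact Or.inl h
    · exact Or.inr ⟨x, y, h⟩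
  · rintro (h | ⟨x, y, hax, hbx, hyb⟩)
    · exact Or.inl h
    · obtain ⟨c, hc, hbc⟩ := hreg b hb
      have hl : b * c * a = a := by
        rw [hbx, ← mul_assoc, ← hbc]
      have hr : a * c * b = a := by
        rw [hyb, mul_assoc y b c, mul_assoc y (b * c) b, ← hbc]
      have hm : a * c * a = a := by
        calc a * c * a = a * c * (b * x) := by rw [← hbx]
          _ = a * c * b * x := (mul_assoc _ _ _).symm
          _ = a := by rw [hr, ← hax]
      refine Or.inr ⟨c * a, T.mul_mem hc ha, a * c, T.mul_mem ha hc, ?_, ?_, hr.symm⟩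
      · rw [← mul_assoc, hm]
      · rw [← mul_assoc, hl]
end

section
/- Let α, β be binary relations on a set X which are both partial injective maps, i.e. each of α and β is functional ((x,y) and (x,z) in the relation imply y = z) and injective ((x,z) and (y,z) in the relation imply x = y). Then α ≤ β in Mitsch's natural partial order if and only if α ⊆ β. -/
/-- For partial injective maps α, β (as binary relations), Mitsch's order
agrees with inclusion. -/
theorem stmt6 {X : Type*} (α β : Set (X × X))
    (hαf : ∀ x y z : X, (x, y) ∈ α → (x, z) ∈ α → y = z)
    (hαi : ∀ x y z : X, (x, z) ∈ α → (y, z) ∈ α → x = y)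
    (hβf : ∀ x y z : X, (x, y) ∈ β → (x, z) ∈ β → y = z)
    (hβi : ∀ x y z : X, (x, z) ∈ β → (y, z) ∈ β → x = y) :
    mitschLe α β ↔ α ⊆ β := by
  constructor
  · rintro (rfl | ⟨ξ, η, h₁, h₂, h₃⟩)
    · exact subset_rfl
    · rintro ⟨x, y⟩ hxy
      obtain ⟨v, hxv, hvy⟩ : (x, y) ∈ rcomp α ξ := h₁ ▸ hxy
      obtain ⟨w, -, hwy⟩ : (x, y) ∈ rcomp η β := h₃ ▸ hxy
      obtain rfl : v = y := hαf x v y hxv hxy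
      have hwα : (w, v) ∈ α := by
        rw [h₂]
        exact ⟨v, hwy, hvy⟩
      obtain rfl : w = x := hαi w x v hwα hxy
      exact hwy
  · intro h
    refine Or.inr ⟨{p | p.1 = p.2 ∧ ∃ x, (x, p.1) ∈ α}, {p | p.1 = p.2 ∧ ∃ y, (p.1, y) ∈ α},
      ?_, ?_, ?_⟩
    · ext ⟨x, y⟩
      constructor
      · intro hxy
        exact ⟨y, hxy, rfl, x, hxy⟩
      · rintro ⟨v, hxy, rfl : v = y, -⟩
        exact hxy
    · ext ⟨x, y⟩
      constructor
      · intro hxy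
        exact ⟨y, h hxy, rfl, x, hxy⟩
      · rintro ⟨v, hxv, rfl : v = y, w, hwv⟩
        obtain rfl : x = w := hβi x w v hxv (h hwv)
        exact hwv
    · ext ⟨x, y⟩
      constructor
      · intro hxy
        exact ⟨x, ⟨rfl, y, hxy⟩, h hxy⟩
      · rintro ⟨v, ⟨rfl : x = v, w, hxw⟩, hxy⟩
        obtain rfl : y = w := hβf x y w hxy (h hxw)
        exact hxw
end

section
/- Let β be a binary relation on a set X which is a partial injective map, i.e. (x,y), (x,z) ∈ β imply y = z and (x,z), (y,z) ∈ β imply x = y. Then for every binary relation α on X, α ⊆ β implies α ≤ β in Mitsch's natural partial order. -/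
/-- If β is a partial injective map, then inclusion in β implies Mitsch's order. -/
theorem stmt7 {X : Type*} (α β : Set (X × X))
    (hβf : ∀ x y z : X, (x, y) ∈ β → (x, z) ∈ β → y = z)
    (hβi : ∀ x y z : X, (x, z) ∈ β → (y, z) ∈ β → x = y)
    (h : α ⊆ β) : mitschLe α β := by
  refine Or.inr ⟨{p | p.1 = p.2 ∧ ∃ x, (x, p.1) ∈ α}, {p | p.1 = p.2 ∧ ∃ y, (p.1, y) ∈ α},
    ?_, ?_, ?_⟩
  · ext ⟨x, y⟩
    constructor
    · intro hxy
      exact ⟨y, hxy, rfl, x, hxy⟩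
    · rintro ⟨z, hxy, hz, _⟩
      obtain rfl : z = y := hz
      exact hxy
  · ext ⟨x, y⟩
    constructor
    · intro hxy
      exact ⟨y, h hxy, rfl, x, hxy⟩
    · rintro ⟨z, hxy, hz, w, hw⟩
      obtain rfl : z = y := hz
      obtain rfl : x = w := hβi _ _ _ hxy (h hw)
      exact hw
  · ext ⟨x, y⟩
    constructor
    · intro hxy
      exact ⟨x, ⟨rfl, y, hxy⟩, h hxy⟩
    · rintro ⟨z, ⟨hz, w, hw⟩, hxy⟩
      obtain rfl : x = z := hz
      obtain rfl : y = w := hβf _ _ _ hxy (h hw)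
      exact hw
end

section
/- For binary relations α, β on a set X, the following are equivalent: (1) α ≤ β in Mitsch's natural partial order and β ⊆ α; (2) there exist binary relations ε and φ on X with ε = ε², φ = φ², ι ⊆ ε, and α = βε = φβ. -/
theorem rcomp_self_of_preorder {X : Type*} {a : Set (X × X)} (hr : ∀ x, (x, x) ∈ a)
    (ht : ∀ x y z, (x, y) ∈ a → (y, z) ∈ a → (x, z) ∈ a) : a = rcomp a a := by
  ext ⟨x, z⟩
  exact ⟨fun h => ⟨x, hr x, h⟩, fun ⟨y, hxy, hyz⟩ => ht x y z hxy hyz⟩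

/-- If `β ⊆ α = α ξ = β ξ`, then `ξ` can be replaced by a preorder, namely the largest relation `ε`
with `α ε ⊆ α`. -/
theorem exists_preorder_eq_rcomp_right {X : Type*} {α β ξ : Set (X × X)} (hβ : β ⊆ α)
    (hα : α = rcomp α ξ) (h : α = rcomp β ξ) :
    ∃ ε : Set (X × X), ε = rcomp ε ε ∧ (∀ x, (x, x) ∈ ε) ∧ α = rcomp β ε := by
  refine ⟨{p | ∀ x, (x, p.1) ∈ α → (x, p.2) ∈ α}, ?_, fun _ _ hx => hx, ?_⟩
  · exact rcomp_self_of_preorder (fun _ _ hx => hx) fun _ _ _ h₁ h₂ x hx => h₂ x (h₁ x hx)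
  · ext ⟨x, z⟩
    constructor
    · intro hxz
      obtain ⟨y, hxy, hyz⟩ := h.subset hxz
      exact ⟨y, hxy, fun w hw => hα.superset ⟨y, hw, hyz⟩⟩
    · rintro ⟨y, hxy, hyz⟩
      exact hyz x (hβ hxy)

/-- Left-hand counterpart of `exists_preorder_eq_rcomp_right`. -/
theorem exists_preorder_eq_rcomp_left {X : Type*} {α β η : Set (X × X)} (hβ : β ⊆ α)
    (hα : α = rcomp η α) (h : α = rcomp η β) :
    ∃ φ : Set (X × X), φ = rcomp φ φ ∧ α = rcomp φ β := by
  refine ⟨{p | ∀ z, (p.2, z) ∈ α → (p.1, z) ∈ α}, ?_, ?_⟩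
  · exact rcomp_self_of_preorder (fun _ _ hx => hx) fun _ _ _ h₁ h₂ z hz => h₁ z (h₂ z hz)
  · ext ⟨x, z⟩
    constructor
    · intro hxz
      obtain ⟨y, hxy, hyz⟩ := h.subset hxz
      exact ⟨y, fun w hw => hα.superset ⟨y, hxy, hw⟩, hyz⟩
    · rintro ⟨y, hxy, hyz⟩
      exact hxy z (hβ hyz)

/-- α ≤ β (Mitsch) together with β ⊆ α iff there are idempotents ε, φ with
ι ⊆ ε and α = βε = φβ. -/
theorem stmt9 {X : Type*} (α β : Set (X × X)) :
    (mitschLe α β ∧ β ⊆ α) ↔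
      ∃ ε φ : Set (X × X), ε = rcomp ε ε ∧ φ = rcomp φ φ ∧
        (∀ x : X, (x, x) ∈ ε) ∧ α = rcomp β ε ∧ α = rcomp φ β := by
  constructor
  · rintro ⟨rfl | ⟨ξ, η, h₁, h₂, h₃⟩, hβ⟩
    · have hid : ({p | p.1 = p.2} : Set (X × X)) =
          rcomp {p | p.1 = p.2} {p | p.1 = p.2} :=
        rcomp_self_of_preorder (fun _ => rfl) fun _ _ _ => Eq.trans
      refine ⟨_, _, hid, hid, fun _ => rfl, ?_, ?_⟩ <;> ext ⟨x, z⟩ <;> simp [rcomp]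
    · have hη : α = rcomp η α := by
        calc α = rcomp α ξ := h₁
          _ = rcomp (rcomp η β) ξ := by rw [← h₃]
          _ = rcomp η α := by rw [rcomp_assoc, ← h₂]
      obtain ⟨ε, hε, hr, hαε⟩ := exists_preorder_eq_rcomp_right hβ h₁ h₂
      obtain ⟨φ, hφ, hαφ⟩ := exists_preorder_eq_rcomp_left hβ hη h₃
      exact ⟨ε, φ, hε, hφ, hr, hαε, hαφ⟩
  · rintro ⟨ε, φ, hε, -, hr, hαε, hαφ⟩
    refine ⟨Or.inr ⟨ε, φ, ?_, hαε, hαφ⟩, ?_⟩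
    · rw [hαε, rcomp_assoc, ← hε]
    · rintro ⟨x, y⟩ hxy
      exact hαε.superset ⟨y, hxy, hr y⟩
end

section
/- For every binary relation β on a set X, βωβ ≤ β in Mitsch's natural partial order, where ω = X × X is the universal relation. -/
/-- For every binary relation β on X, βωβ ≤ β in Mitsch's order, where ω = X × X. -/
theorem stmt10 {X : Type*} (β : Set (X × X)) :
    mitschLe (rcomp (rcomp β Set.univ) β) β := by
  refine Or.inr ⟨rcomp Set.univ β, rcomp β Set.univ, ?_, ?_, rfl⟩
  · ext ⟨x, z⟩
    constructor
    · rintro ⟨y, ⟨w, hxw, -⟩, hyz⟩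
      exact ⟨w, ⟨x, ⟨w, hxw, trivial⟩, hxw⟩, y, trivial, hyz⟩
    · rintro ⟨_, ⟨_, ⟨w, hxw, -⟩, -⟩, y, -, hyz⟩
      exact ⟨y, ⟨w, hxw, trivial⟩, hyz⟩
  · ext ⟨x, z⟩
    constructor
    · rintro ⟨y, ⟨w, hxw, -⟩, hyz⟩
      exact ⟨w, hxw, y, trivial, hyz⟩
    · rintro ⟨w, hxw, y, -, hyz⟩
      exact ⟨y, ⟨w, hxw, trivial⟩, hyz⟩
end

section
/- For binary relations α, β on a set X, there exists a binary relation γ on X such that α ⊆ γ and γ ≤ β in Mitsch's natural partial order if and only if αωα ⊆ βωβ, where ω = X × X is the universal relation. -/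
/-- `a ω b` is the product of the domain of `a` and the image of `b`. -/
theorem mem_rcomp_univ_rcomp {X : Type*} {a b : Set (X × X)} {x z : X} :
    (x, z) ∈ rcomp (rcomp a Set.univ) b ↔ (∃ y, (x, y) ∈ a) ∧ ∃ y, (y, z) ∈ b := by
  simp only [rcomp, Set.mem_ofPred_eq, Set.mem_univ, and_true]
  exact exists_and_left

theorem rcomp_univ_rcomp_mitschLe {X : Type*} (b : Set (X × X)) :
    mitschLe (rcomp (rcomp b Set.univ) b) b := by
  refine Or.inr ⟨rcomp Set.univ b, rcomp b Set.univ, ?_, ?_, rfl⟩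
  all_goals
    ext ⟨x, z⟩
    simp only [rcomp, Set.mem_ofPred_eq, Set.mem_univ, and_true, true_and]
    grind

/-- There exists γ with α ⊆ γ ≤ β (Mitsch) iff αωα ⊆ βωβ. -/
theorem stmt11 {X : Type*} (α β : Set (X × X)) :
    (∃ γ : Set (X × X), α ⊆ γ ∧ mitschLe γ β) ↔
      rcomp (rcomp α Set.univ) α ⊆ rcomp (rcomp β Set.univ) β := by
  constructor
  · rintro ⟨γ, hαγ, hγβ⟩ ⟨x, z⟩ h
    rw [mem_rcomp_univ_rcomp] at h ⊢
    obtain ⟨⟨y, hy⟩, w, hw⟩ := h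
    obtain rfl | ⟨ξ, η, -, hξ, hη⟩ := hγβ
    · exact ⟨⟨y, hαγ hy⟩, w, hαγ hw⟩
    · have hx : (x, y) ∈ rcomp β ξ := hξ ▸ hαγ hy
      have hz : (w, z) ∈ rcomp η β := hη ▸ hαγ hw
      exact ⟨hx.imp fun _ h => h.1, hz.imp fun _ h => h.2⟩
  · intro h
    refine ⟨_, fun ⟨x, z⟩ hxz => h ?_, rcomp_univ_rcomp_mitschLe β⟩
    exact mem_rcomp_univ_rcomp.mpr ⟨⟨z, hxz⟩, x, hxz⟩
end

section
/- For binary relations α, β on a set X: if there exists γ with α ≤ γ (Mitsch order) and γ ⊆ β, then there exists δ with α ⊆ δ and δ ≤ β (Mitsch order). In other words, the composite relation ≤∘⊆ is contained in the composite relation ⊆∘≤ on B_X. -/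
/-- The rectangle `dom b × im b` spanned by a relation lies below `b` in Mitsch's order. -/
theorem mitschLe_dom_prod_im {X : Type*} (b : Set (X × X)) :
    mitschLe {p : X × X | (∃ y, (p.1, y) ∈ b) ∧ ∃ x, (x, p.2) ∈ b} b := by
  refine Or.inr ⟨{p | ∃ x, (x, p.2) ∈ b}, {p | ∃ y, (p.1, y) ∈ b}, ?_, ?_, ?_⟩
  · ext ⟨x, z⟩
    exact ⟨fun ⟨⟨y, hy⟩, hz⟩ => ⟨y, ⟨⟨y, hy⟩, x, hy⟩, hz⟩, fun ⟨_, ⟨hx, _⟩, hz⟩ => ⟨hx, hz⟩⟩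
  · ext ⟨x, z⟩
    exact ⟨fun ⟨⟨y, hy⟩, hz⟩ => ⟨y, hy, hz⟩, fun ⟨y, hy, hz⟩ => ⟨⟨y, hy⟩, hz⟩⟩
  · ext ⟨x, z⟩
    exact ⟨fun ⟨hx, w, hw⟩ => ⟨w, hx, hw⟩, fun ⟨w, hx, hw⟩ => ⟨hx, w, hw⟩⟩

/-- A relation below `c` in Mitsch's order is contained in the rectangle `dom c × im c`. -/
theorem mitschLe.mem_dom_and_mem_im {X : Type*} {a c : Set (X × X)} (h : mitschLe a c)
    {p : X × X} (hp : p ∈ a) : (∃ y, (p.1, y) ∈ c) ∧ ∃ x, (x, p.2) ∈ c := by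
  rcases h with rfl | ⟨ξ, η, -, hξ, hη⟩
  · exact ⟨⟨p.2, hp⟩, p.1, hp⟩
  · obtain ⟨y, hy, -⟩ : p ∈ rcomp c ξ := hξ ▸ hp
    obtain ⟨x, -, hx⟩ : p ∈ rcomp η c := hη ▸ hp
    exact ⟨⟨y, hy⟩, x, hx⟩

/-- The composite ≤∘⊆ is contained in ⊆∘≤ on binary relations. -/
theorem stmt12 {X : Type*} (α β : Set (X × X))
    (h : ∃ γ : Set (X × X), mitschLe α γ ∧ γ ⊆ β) :
    ∃ δ : Set (X × X), α ⊆ δ ∧ mitschLe δ β := by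
  obtain ⟨γ, hαγ, hγβ⟩ := h
  refine ⟨_, fun p hp => ?_, mitschLe_dom_prod_im β⟩
  obtain ⟨⟨y, hy⟩, x, hx⟩ := hαγ.mem_dom_and_mem_im hp
  exact ⟨⟨y, hγβ hy⟩, x, hγβ hx⟩
end

section
/- Define the relation R on binary relations over a set X by: R(α, β) iff there exists γ with α ⊆ γ and γ ≤ β in Mitsch's natural partial order. Then R is reflexive and transitive (a preorder on B_X), and R is the least such: every reflexive transitive relation Q on B_X that contains both inclusion ⊆ and Mitsch's order ≤ contains R. Hence R is the join of ⊆ and ≤ in the lattice of preorders on B_X. -/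
/-- The rectangle `dom b × im b` lies below `b` in Mitsch's order. -/
theorem mitschLe_dom_prod_im_s13 {X : Type*} (b : Set (X × X)) :
    mitschLe ((Prod.fst '' b) ×ˢ (Prod.snd '' b)) b := by
  refine Or.inr ⟨Set.univ ×ˢ (Prod.snd '' b), (Prod.fst '' b) ×ˢ Set.univ, ?_, ?_, ?_⟩ <;>
    ext ⟨x, z⟩ <;> simp [rcomp] <;> grind

/-- A relation below `b` in Mitsch's order is contained in `dom b × im b`. -/
theorem mitschLe.subset_dom_prod_im {X : Type*} {a b : Set (X × X)} (h : mitschLe a b) :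
    a ⊆ (Prod.fst '' b) ×ˢ (Prod.snd '' b) := by
  rcases h with rfl | ⟨ξ, η, -, hξ, hη⟩
  · exact fun p hp => ⟨⟨p, hp, rfl⟩, ⟨p, hp, rfl⟩⟩
  · intro p hp
    obtain ⟨y, hy, -⟩ := hξ.subset hp
    obtain ⟨z, -, hz⟩ := hη.subset hp
    exact ⟨⟨_, hy, rfl⟩, ⟨_, hz, rfl⟩⟩

/-- `a` is contained in some relation Mitsch-below `b` iff `a ⊆ dom b × im b`. -/
theorem exists_subset_mitschLe_iff {X : Type*} {a b : Set (X × X)} :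
    (∃ γ, a ⊆ γ ∧ mitschLe γ b) ↔ a ⊆ (Prod.fst '' b) ×ˢ (Prod.snd '' b) :=
  ⟨fun ⟨_, ha, hγ⟩ => ha.trans hγ.subset_dom_prod_im,
    fun h => ⟨_, h, mitschLe_dom_prod_im_s13 b⟩⟩

/-- The relation R(α,β) ⟺ ∃ γ, α ⊆ γ ∧ γ ≤ β (Mitsch) is a preorder on B_X,
and it is the least preorder containing both ⊆ and ≤; hence it is their join
in the lattice of preorders. -/
theorem stmt13 {X : Type*} :
    (∀ a : Set (X × X), ∃ γ, a ⊆ γ ∧ mitschLe γ a) ∧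
    (∀ a b c : Set (X × X),
      (∃ γ, a ⊆ γ ∧ mitschLe γ b) → (∃ γ, b ⊆ γ ∧ mitschLe γ c) →
      ∃ γ, a ⊆ γ ∧ mitschLe γ c) ∧
    (∀ Q : Set (X × X) → Set (X × X) → Prop,
      (∀ a, Q a a) →
      (∀ a b c, Q a b → Q b c → Q a c) →
      (∀ a b : Set (X × X), a ⊆ b → Q a b) →
      (∀ a b : Set (X × X), mitschLe a b → Q a b) →
      ∀ a b : Set (X × X), (∃ γ, a ⊆ γ ∧ mitschLe γ b) → Q a b) := by
  refine ⟨fun a => ⟨a, subset_rfl, Or.inl rfl⟩, fun a b c hab hbc => ?_,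
    fun Q _ htrans hsub hle a b ⟨γ, ha, hγ⟩ => htrans a γ b (hsub a γ ha) (hle γ b hγ)⟩
  rw [exists_subset_mitschLe_iff] at hab hbc ⊢
  refine hab.trans (Set.prod_mono ?_ ?_)
  · rintro _ ⟨p, hp, rfl⟩
    exact (hbc hp).1
  · rintro _ ⟨p, hp, rfl⟩
    exact (hbc hp).2
end

section
/- Let X be a set with at least two distinct elements. Then there is no binary relation α on X with ι ≤ α in Mitsch's natural partial order and ω ⊆ α, where ι is the identity relation and ω = X × X. Hence the composite ≤∘⊇ is properly contained in the composite ⊇∘≤ (which is the universal relation on B_X). -/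
/-- The empty relation is below every relation in Mitsch's order. -/
theorem mitschLe_empty {X : Type*} (b : Set (X × X)) : mitschLe ∅ b :=
  Or.inr ⟨∅, ∅, by simp [rcomp], by simp [rcomp], by simp [rcomp]⟩

/-- On a set with two distinct points, the identity is not below a relation containing `X × X`. -/
theorem not_mitschLe_id_of_univ_subset {X : Type*} {x y : X} (hxy : x ≠ y) {α : Set (X × X)}
    (hα : (Set.univ : Set (X × X)) ⊆ α) : ¬ mitschLe {p : X × X | p.1 = p.2} α := by
  rintro (h | ⟨_, η, -, -, h⟩)
  · have hmem : (x, y) ∈ {p : X × X | p.1 = p.2} := h ▸ hα (Set.mem_univ (x, y))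
    exact hxy hmem
  · have hx : (x, x) ∈ rcomp η α := h ▸ (rfl : x = x)
    obtain ⟨w, hw, -⟩ := hx
    have hmem : (x, y) ∈ {p : X × X | p.1 = p.2} := by
      rw [h]
      exact ⟨w, hw, hα (Set.mem_univ _)⟩
    exact hxy hmem

/-- If X has two distinct elements, there is no α with ι ≤ α (Mitsch) and
ω ⊆ α; hence the composite ≤∘⊇ is properly contained in ⊇∘≤ (which is the
universal relation on B_X). -/
theorem stmt16 {X : Type*} (x y : X) (hxy : x ≠ y) :
    (¬ ∃ α : Set (X × X), mitschLe {p : X × X | p.1 = p.2} α ∧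
        (Set.univ : Set (X × X)) ⊆ α) ∧
    {q : Set (X × X) × Set (X × X) | ∃ c, mitschLe q.1 c ∧ q.2 ⊆ c} ⊂
      {q : Set (X × X) × Set (X × X) | ∃ c, c ⊆ q.1 ∧ mitschLe c q.2} := by
  have hno : ¬ ∃ α : Set (X × X), mitschLe {p : X × X | p.1 = p.2} α ∧
      (Set.univ : Set (X × X)) ⊆ α :=
    fun ⟨_, hle, hsub⟩ => not_mitschLe_id_of_univ_subset hxy hsub hle
  refine ⟨hno, fun q _ => ⟨∅, Set.empty_subset _, mitschLe_empty _⟩, fun hsub => hno ?_⟩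
  exact hsub (a := ({p : X × X | p.1 = p.2}, Set.univ))
    ⟨∅, Set.empty_subset _, mitschLe_empty _⟩
end

section
/- Every inclusion atom of B_X is a Mitsch atom: let x, y ∈ X and let α = {(x, y)} be a singleton binary relation on X. If β is a non-empty binary relation on X with β ≤ α in Mitsch's natural partial order, then β = α. -/
/-- Every inclusion atom (a singleton relation) is a Mitsch atom: a non-empty
β with β ≤ {(x,y)} (Mitsch) equals {(x,y)}. -/
theorem stmt17 {X : Type*} (x y : X) (β : Set (X × X)) (hβ : β.Nonempty)
    (h : mitschLe β {(x, y)}) : β = {(x, y)} := by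
  obtain h | ⟨ξ, η, -, hξ, hη⟩ := h
  · exact h
  refine hβ.subset_singleton_iff.mp ?_
  rintro ⟨a, b⟩ hab
  have ha : (a, b) ∈ rcomp {(x, y)} ξ := hξ ▸ hab
  have hb : (a, b) ∈ rcomp η {(x, y)} := hη ▸ hab
  obtain ⟨u, hu, -⟩ := ha
  obtain ⟨v, -, hv⟩ := hb
  exact Prod.ext (Prod.ext_iff.mp hu).1 (Prod.ext_iff.mp hv).2
end

section
/- Permutations of X are maximal in Mitsch's natural partial order: let f : X → X be a bijection and π = {(x, f(x)) : x ∈ X} its graph, regarded as a binary relation on X. If α is a binary relation on X with π ≤ α in Mitsch's natural partial order, then α = π. -/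
/-- Graphs of permutations are maximal in Mitsch's order. -/
theorem stmt18 {X : Type*} (f : X → X) (hf : Function.Bijective f)
    (α : Set (X × X)) (h : mitschLe {p : X × X | p.2 = f p.1} α) :
    α = {p : X × X | p.2 = f p.1} := by
  rcases h with h | ⟨ξ, -, hξ, hα, -⟩
  · exact h.symm
  have ξ_eq_id : ∀ y z, (y, z) ∈ ξ ↔ z = y := by
    intro y z
    obtain ⟨x, rfl⟩ := hf.surjective y
    have hx := Set.ext_iff.mp hξ (x, z)
    simpa [rcomp] using hx.symm
  rw [hα]
  ext ⟨x, z⟩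
  simp [rcomp, ξ_eq_id]
end
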